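/- Let A₁, B₁, A₂, B₂ be nonempty finite types and let P₁ be a projection on ℂ^(A₁×B₁) and P₂ a projection on ℂ^(A₂×B₂) such that Tr_{B₁}(P₁) and Tr_{B₂}(P₂) are positive definite. Then the revised semidefinite packing number is multiplicative under tensor products: Ã(P₁ ⊠ P₂) = Ã(P₁) · Ã(P₂). -/

import Mathlib

open Matrix Kronecker BigOperators
open scoped ComplexOrder

noncomputable section

/-- Loewner order: `M ≤ N` iff `N - M` is positive semidefinite. -/
def loe {n : Type*} [Fintype n] (M N : Matrix n n ℂ) : Prop := (N - M).PosSemidef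

/-- A projection: Hermitian and idempotent. -/
def IsProj {n : Type*} [Fintype n] (M : Matrix n n ℂ) : Prop := M.IsHermitian ∧ M * M = M

variable {A B : Type*} [Fintype A] [Fintype B] [DecidableEq A] [DecidableEq B]

/-- Partial trace over `A`. -/
def trA (M : Matrix (A × B) (A × B) ℂ) : Matrix B B ℂ :=
  Matrix.of fun b b' => ∑ a, M (a, b) (a, b')

/-- Partial trace over `B`. -/
def trB (M : Matrix (A × B) (A × B) ℂ) : Matrix A A ℂ :=
  Matrix.of fun a a' => ∑ b, M (a, b) (a', b)

/-- `P` supports a quantum channel: there is a PSD `J` supported on `P` with `Tr_B J = 1`. -/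
def SupportsChannel (P : Matrix (A × B) (A × B) ℂ) : Prop :=
  ∃ J : Matrix (A × B) (A × B) ℂ, J.PosSemidef ∧ P * J = J ∧ trB J = 1

/-- Revised semidefinite packing number (primal SDP). -/
def AramTilde (P : Matrix (A × B) (A × B) ℂ) : ℝ :=
  sSup { x : ℝ | ∃ S : Matrix A A ℂ, S.PosSemidef ∧ x = S.trace.re ∧
    loe (trA (P * (S ⊗ₖ (1 : Matrix B B ℂ)) * P)) 1 }

/-- Tensor product of non-commutative bipartite graphs (projections). -/
def boxProd {A₁ B₁ A₂ B₂ : Type*}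
    (P₁ : Matrix (A₁ × B₁) (A₁ × B₁) ℂ) (P₂ : Matrix (A₂ × B₂) (A₂ × B₂) ℂ) :
    Matrix ((A₁ × A₂) × (B₁ × B₂)) ((A₁ × A₂) × (B₁ × B₂)) ℂ :=
  Matrix.of fun x y =>
    P₁ (x.1.1, x.2.1) (y.1.1, y.2.1) * P₂ (x.1.2, x.2.2) (y.1.2, y.2.2)

section helpers

open scoped MatrixOrder in
lemma exists_factor {n : Type*} [Fintype n] {M : Matrix n n ℂ} (hM : M.PosSemidef) :
    ∃ X : Matrix n n ℂ, M = Xᴴ * X := by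
  classical
  exact (CStarAlgebra.nonneg_iff_eq_star_mul_self (a := M)).1 hM.nonneg

lemma psd_of_re {n : Type*} [Fintype n] {M : Matrix n n ℂ} (hM : M.IsHermitian)
    (h : ∀ x : n → ℂ, 0 ≤ (M * vecMulVec x (star x)).trace.re) : M.PosSemidef := by
  refine PosSemidef.of_dotProduct_mulVec_nonneg hM fun x => ?_
  rw [Complex.nonneg_iff]
  refine ⟨?_, ?_⟩
  · have := h x
    rwa [mul_vecMulVec, trace_vecMulVec, dotProduct_comm] at this
  · exact (hM.im_star_dotProduct_mulVec_self x).symm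

lemma trace_mul_psd_nonneg {n : Type*} [Fintype n] {M N : Matrix n n ℂ} (hM : M.PosSemidef)
    (hN : N.PosSemidef) : 0 ≤ (M * N).trace.re := by
  classical
  obtain ⟨X, rfl⟩ := exists_factor hN
  rw [← Matrix.mul_assoc, Matrix.trace_mul_comm, ← Matrix.mul_assoc]
  exact (Complex.nonneg_iff.1 (hM.mul_mul_conjTranspose_same X).trace_nonneg).1

lemma psd_isClosed {n : Type*} [Fintype n] : IsClosed {M : Matrix n n ℂ | M.PosSemidef} := by
  have : {M : Matrix n n ℂ | M.PosSemidef} =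
      {M : Matrix n n ℂ | Mᴴ = M} ∩ ⋂ x : n → ℂ, {M | 0 ≤ (M * vecMulVec x (star x)).trace.re} := by
    ext M
    simp only [Set.mem_ofPred_eq, Set.mem_inter_iff, Set.mem_iInter]
    constructor
    · intro h
      exact ⟨h.isHermitian, fun x => trace_mul_psd_nonneg h (posSemidef_vecMulVec_self_star x)⟩
    · rintro ⟨h, h'⟩
      exact psd_of_re h h'
  rw [this]
  refine IsClosed.inter (isClosed_eq (by fun_prop) (by fun_prop)) (isClosed_iInter fun x => ?_)
  refine isClosed_le (by fun_prop) ?_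
  exact Complex.continuous_re.comp (Continuous.matrix_trace (by fun_prop))

lemma trace_conj_mul {n : Type*} [Fintype n] (X : Matrix n n ℂ) :
    (Xᴴ * X).trace.re = ∑ i, ∑ j, ‖X j i‖ ^ 2 := by
  simp only [Matrix.trace, Matrix.diag, Matrix.mul_apply, Complex.re_sum, conjTranspose_apply]
  refine Finset.sum_congr rfl fun i _ => Finset.sum_congr rfl fun j _ => ?_
  rw [← Complex.normSq_eq_norm_sq, Complex.normSq_apply]
  simp

lemma psd_compact {n : Type*} [Fintype n] (β : ℝ) :
    IsCompact {T : Matrix n n ℂ | T.PosSemidef ∧ T.trace.re ≤ β} := by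
  classical
  have : {T : Matrix n n ℂ | T.PosSemidef ∧ T.trace.re ≤ β} =
      (fun X : Matrix n n ℂ => Xᴴ * X) '' {X : Matrix n n ℂ | ∑ i, ∑ j, ‖X j i‖ ^ 2 ≤ β} := by
    ext T
    simp only [Set.mem_ofPred_eq, Set.mem_image]
    constructor
    · rintro ⟨h, h'⟩
      obtain ⟨X, rfl⟩ := exists_factor h
      exact ⟨X, by rw [← trace_conj_mul]; exact h', rfl⟩
    · rintro ⟨X, h, rfl⟩
      exact ⟨posSemidef_conjTranspose_mul_self X, by rw [trace_conj_mul]; exact h⟩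
  rw [this]
  refine IsCompact.image ?_ (by fun_prop)
  have hK : IsCompact (Set.univ.pi fun _ : n => Set.univ.pi fun _ : n =>
      Metric.closedBall (0 : ℂ) (Real.sqrt β)) :=
    isCompact_univ_pi fun _ => isCompact_univ_pi fun _ => isCompact_closedBall _ _
  refine hK.of_isClosed_subset ?_ ?_
  · refine isClosed_le ?_ continuous_const
    refine continuous_finsetSum _ fun i _ => continuous_finsetSum _ fun j _ => ?_
    exact ((continuous_apply_apply j i).norm).pow 2
  · intro X hX i _ j _
    replace hX : ∑ i, ∑ j, ‖X j i‖ ^ 2 ≤ β := hX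
    rw [mem_closedBall_zero_iff]
    apply Real.le_sqrt_of_sq_le
    refine le_trans ?_ hX
    refine le_trans ?_ (Finset.single_le_sum (f := fun i => ∑ j, ‖X j i‖ ^ 2)
      (fun _ _ => Finset.sum_nonneg fun _ _ => by positivity) (Finset.mem_univ j))
    exact Finset.single_le_sum (f := fun k => ‖X k j‖ ^ 2) (fun _ _ => by positivity) (Finset.mem_univ i)

open Pointwise in
lemma strong_duality {A B : Type*} [Fintype A] [Fintype B] [DecidableEq A]
    (L : Matrix B B ℂ →ₗ[ℂ] Matrix A A ℂ) (hL : ∀ T, T.PosSemidef → (L T).PosSemidef)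
    {β : ℝ} (hβ : 0 < β)
    (h : ¬ ∃ T : Matrix B B ℂ, T.PosSemidef ∧ T.trace.re ≤ β ∧ (L T - 1).PosSemidef) :
    ∃ S : Matrix A A ℂ, S.PosSemidef ∧ β < S.trace.re ∧
      ∀ v : B → ℂ, (L (vecMulVec v (star v)) * S).trace.re ≤ (star v ⬝ᵥ v).re := by
  classical
  set K : Set (Matrix B B ℂ) := {T | T.PosSemidef ∧ T.trace.re ≤ β} with hK
  set D : Set (Matrix A A ℂ) := L '' K + (fun R => -R) '' {R | R.PosSemidef} with hD
  have hpc : Convex ℝ {R : Matrix A A ℂ | R.PosSemidef} := by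
    intro x hx y hy a b ha hb _
    exact (PosSemidef.smul hx ha).add (PosSemidef.smul hy hb)
  have hKc : Convex ℝ K := by
    intro x hx y hy a b ha hb hab
    refine ⟨(PosSemidef.smul hx.1 ha).add (PosSemidef.smul hy.1 hb), ?_⟩
    simp only [trace_add, trace_smul, Complex.add_re, Complex.real_smul, Complex.re_ofReal_mul]
    have h1 := mul_le_mul_of_nonneg_left hx.2 ha
    have h2 := mul_le_mul_of_nonneg_left hy.2 hb
    calc _ ≤ a * β + b * β := add_le_add h1 h2
      _ = β := by rw [← add_mul, hab, one_mul]
  have hDconv : Convex ℝ D := by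
    refine Convex.add ?_ ?_
    · exact hKc.linear_image (L.restrictScalars ℝ)
    · have := hpc.linear_image (-LinearMap.id : Matrix A A ℂ →ₗ[ℝ] Matrix A A ℂ)
      simpa using this
  have hDclosed : IsClosed D := by
    refine IsClosed.add_left_of_isCompact ?_ ?_
    · rw [Set.image_neg_eq_neg]
      exact psd_isClosed.neg
    · exact (psd_compact β).image (L.continuous_of_finiteDimensional)
  have h1 : (1 : Matrix A A ℂ) ∉ D := by
    rintro ⟨_, ⟨T, hT, rfl⟩, _, ⟨R, hR, rfl⟩, e⟩
    refine h ⟨T, hT.1, hT.2, ?_⟩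
    have : L T - 1 = R := by
      rw [← e]; simp
    rw [this]; exact hR
  haveI : LocallyConvexSpace ℝ (Matrix A A ℂ) :=
    inferInstanceAs (LocallyConvexSpace ℝ (A → A → ℂ))
  obtain ⟨f, u, hf, hu⟩ := RCLike.geometric_hahn_banach_closed_point (𝕜 := ℂ) hDconv hDclosed h1
  simp only [RCLike.re_to_complex] at hf hu
  have hfTR : ∀ T R, T.PosSemidef → T.trace.re ≤ β → R.PosSemidef → (f (L T)).re - (f R).re < u := by
    intro T R hT hT' hR
    have := hf (L T + -R) ⟨_, ⟨T, ⟨hT, hT'⟩, rfl⟩, _, ⟨R, hR, rfl⟩, rfl⟩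
    simpa [sub_eq_add_neg] using this
  have hu0 : 0 < u := by
    have := hfTR 0 0 .zero (by simpa using hβ.le) .zero
    simpa using this
  have hfR : ∀ R, R.PosSemidef → 0 ≤ (f R).re := by
    intro R hR
    by_contra hneg
    push Not at hneg
    have hc : 0 ≤ u / (-(f R).re) := by
      apply div_nonneg hu0.le; linarith
    have := hfTR 0 ((u / (-(f R).re)) • R) .zero (by simpa using hβ.le) (PosSemidef.smul hR hc)
    rw [← Complex.coe_smul] at this
    simp only [map_zero, Complex.zero_re, map_smul, smul_eq_mul, Complex.re_ofReal_mul] at this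
    have h3 : u / (-(f R).re) * (f R).re = -u := by
      have : (f R).re ≠ 0 := hneg.ne
      field_simp
    linarith
  -- represent f
  set G : Matrix A A ℂ := Matrix.of fun i j => f (Matrix.single j i 1) with hG
  have hfG : ∀ X, f X = (X * G).trace := by
    intro X
    conv_lhs => rw [matrix_eq_sum_single X]
    simp only [map_sum, Matrix.trace, Matrix.diag, Matrix.mul_apply]
    refine Finset.sum_congr rfl fun i _ => Finset.sum_congr rfl fun j _ => ?_
    have : Matrix.single i j (X i j) = X i j • Matrix.single i j (1:ℂ) := by
      simp
    rw [this, map_smul, smul_eq_mul, hG]; rfl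
  set S : Matrix A A ℂ := (1/2 : ℝ) • (G + Gᴴ) with hS
  have hSh : S.IsHermitian := by
    simp [hS, Matrix.IsHermitian, add_comm]
  have hfS : ∀ X : Matrix A A ℂ, X.IsHermitian → (X * S).trace.re = (f X).re := by
    intro X hX
    have e : (X * Gᴴ).trace = star (X * G).trace := by
      rw [← trace_conjTranspose, conjTranspose_mul, hX.eq, trace_mul_comm]
    rw [hS, Matrix.mul_smul, trace_smul, Matrix.mul_add, trace_add, e, ← hfG, Complex.real_smul,
      Complex.re_ofReal_mul, Complex.add_re]
    simp; ring
  have hSpsd : S.PosSemidef := by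
    refine psd_of_re hSh fun x => ?_
    have hp := posSemidef_vecMulVec_self_star x
    rw [trace_mul_comm, hfS _ hp.isHermitian]
    exact hfR _ hp
  have hStr : u < S.trace.re := by
    have := hfS 1 Matrix.isHermitian_one
    rw [Matrix.one_mul] at this
    rwa [this]
  refine ⟨(β / u) • S, PosSemidef.smul hSpsd (by positivity), ?_, ?_⟩
  · rw [trace_smul, Complex.real_smul, Complex.re_ofReal_mul, div_mul_eq_mul_div, lt_div_iff₀ hu0]
    exact mul_lt_mul_of_pos_left hStr hβ
  · intro v
    by_cases hv : v = 0
    · subst hv; simp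
    have hv' : 0 < (star v ⬝ᵥ v).re :=
      (Complex.pos_iff.1 (dotProduct_star_self_pos_iff.2 hv)).1
    have hp := posSemidef_vecMulVec_self_star v
    set t := (star v ⬝ᵥ v).re with ht
    have := hfTR ((β / t) • vecMulVec v (star v)) 0 (PosSemidef.smul hp (by positivity))
      (by rw [trace_smul, trace_vecMulVec, dotProduct_comm, Complex.real_smul,
            Complex.re_ofReal_mul, ← ht, div_mul_cancel₀ _ hv'.ne']) .zero
    rw [← Complex.coe_smul] at this
    simp only [map_zero, Complex.zero_re, map_smul, smul_eq_mul, Complex.re_ofReal_mul,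
      sub_zero] at this
    rw [Matrix.mul_smul, trace_smul, Complex.real_smul, Complex.re_ofReal_mul,
      hfS _ (hL _ hp).isHermitian]
    rw [div_mul_eq_mul_div, div_lt_iff₀ hv'] at this
    rw [div_mul_eq_mul_div, div_le_iff₀ hu0]
    linarith

section PT
variable {A B : Type*} [Fintype A] [Fintype B] [DecidableEq A] [DecidableEq B]

lemma trA_psd {M : Matrix (A × B) (A × B) ℂ} (hM : M.PosSemidef) : (trA M).PosSemidef := by
  have : trA M = ∑ a, M.submatrix (fun b => (a, b)) (fun b => (a, b)) := by
    ext b b'; simp [trA, Matrix.sum_apply]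
  rw [this]
  exact posSemidef_sum _ fun a _ => hM.submatrix _

lemma trB_psd {M : Matrix (A × B) (A × B) ℂ} (hM : M.PosSemidef) : (trB M).PosSemidef := by
  have : trB M = ∑ b, M.submatrix (fun a => (a, b)) (fun a => (a, b)) := by
    ext b b'; simp [trB, Matrix.sum_apply]
  rw [this]
  exact posSemidef_sum _ fun a _ => hM.submatrix _

lemma trace_trA (M : Matrix (A × B) (A × B) ℂ) (T : Matrix B B ℂ) :
    (trA M * T).trace = (M * ((1 : Matrix A A ℂ) ⊗ₖ T)).trace := by
  have h : ∀ a b, ∑ a', ∑ b', M (a, b) (a', b') * ((1 : Matrix A A ℂ) a' a * T b' b) =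
      ∑ b', M (a, b) (a, b') * T b' b := by
    intro a b
    rw [Finset.sum_eq_single a]
    · simp
    · intro a' _ h; simp [Matrix.one_apply_ne h]
    · simp
  simp only [Matrix.trace, Matrix.diag, Matrix.mul_apply, trA, of_apply, Fintype.sum_prod_type,
    kroneckerMap_apply, h, Finset.sum_mul]
  rw [Finset.sum_comm]
  conv_lhs => rw [Finset.sum_comm]
  conv_lhs => enter [2, b]; rw [Finset.sum_comm]
  conv_lhs => rw [Finset.sum_comm]

lemma trace_trB (M : Matrix (A × B) (A × B) ℂ) (S : Matrix A A ℂ) :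
    (trB M * S).trace = (M * (S ⊗ₖ (1 : Matrix B B ℂ))).trace := by
  have h : ∀ a b, ∑ a', ∑ b', M (a, b) (a', b') * (S a' a * (1 : Matrix B B ℂ) b' b) =
      ∑ a', M (a, b) (a', b) * S a' a := by
    intro a b
    refine Finset.sum_congr rfl fun a' _ => ?_
    rw [Finset.sum_eq_single b]
    · simp
    · intro a' _ h; simp [Matrix.one_apply_ne h]
    · simp
  simp only [Matrix.trace, Matrix.diag, Matrix.mul_apply, trB, of_apply, Fintype.sum_prod_type,
    kroneckerMap_apply, h, Finset.sum_mul]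
  refine Finset.sum_congr rfl fun a _ => ?_
  rw [Finset.sum_comm]

/-- primal map -/
def prim (P : Matrix (A × B) (A × B) ℂ) (S : Matrix A A ℂ) : Matrix B B ℂ :=
  trA (P * (S ⊗ₖ (1 : Matrix B B ℂ)) * P)

/-- dual map -/
def dua (P : Matrix (A × B) (A × B) ℂ) : Matrix B B ℂ →ₗ[ℂ] Matrix A A ℂ where
  toFun T := trB (P * ((1 : Matrix A A ℂ) ⊗ₖ T) * P)
  map_add' x y := by
    rw [kronecker_add, Matrix.mul_add, Matrix.add_mul]
    ext; simp [trB, Finset.sum_add_distrib]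
  map_smul' c x := by
    rw [kronecker_smul, Matrix.mul_smul, Matrix.smul_mul]
    ext; simp [trB, Finset.mul_sum]

lemma dua_apply (P : Matrix (A × B) (A × B) ℂ) (T : Matrix B B ℂ) :
    dua P T = trB (P * ((1 : Matrix A A ℂ) ⊗ₖ T) * P) := rfl

lemma adj (P : Matrix (A × B) (A × B) ℂ) (S : Matrix A A ℂ) (T : Matrix B B ℂ) :
    (dua P T * S).trace = (prim P S * T).trace := by
  rw [dua_apply, prim, trace_trA, trace_trB]
  rw [Matrix.mul_assoc, trace_mul_comm]
  simp only [Matrix.mul_assoc]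
  

lemma prim_psd {P : Matrix (A × B) (A × B) ℂ} (hP : IsProj P) {S : Matrix A A ℂ}
    (hS : S.PosSemidef) : (prim P S).PosSemidef := by
  refine trA_psd ?_
  have := (hS.kronecker (PosSemidef.one (n := B) (R := ℂ))).conjTranspose_mul_mul_same P
  rwa [hP.1.eq] at this

lemma dua_psd {P : Matrix (A × B) (A × B) ℂ} (hP : IsProj P) {T : Matrix B B ℂ}
    (hT : T.PosSemidef) : (dua P T).PosSemidef := by
  refine trB_psd ?_
  have := ((PosSemidef.one (n := A) (R := ℂ)).kronecker hT).conjTranspose_mul_mul_same P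
  rwa [hP.1.eq] at this

/-- feasible set -/
def feas (P : Matrix (A × B) (A × B) ℂ) : Set ℝ :=
  { x : ℝ | ∃ S : Matrix A A ℂ, S.PosSemidef ∧ x = S.trace.re ∧
    (1 - prim P S).PosSemidef }

lemma aram_eq (P : Matrix (A × B) (A × B) ℂ) : AramTilde P = sSup (feas P) := rfl

lemma weak {P : Matrix (A × B) (A × B) ℂ} {x : ℝ} (hx : x ∈ feas P)
    {T : Matrix B B ℂ} (hT : T.PosSemidef) (hT' : (dua P T - 1).PosSemidef) :
    x ≤ T.trace.re := by
  obtain ⟨S, hS, rfl, h⟩ := hx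
  have h1 := trace_mul_psd_nonneg hT' hS
  have h2 := trace_mul_psd_nonneg h hT
  rw [Matrix.sub_mul, trace_sub, Complex.sub_re, Matrix.one_mul] at h1 h2
  rw [adj] at h1
  linarith

lemma feas_zero (P : Matrix (A × B) (A × B) ℂ) : (0 : ℝ) ∈ feas P := by
  refine ⟨0, .zero, by simp, ?_⟩
  have : prim P 0 = 0 := by ext; simp [prim, trA]
  rw [this, sub_zero]
  exact .one

lemma exists_dual {P : Matrix (A × B) (A × B) ℂ} (hP : IsProj P) (hPD : (trB P).PosDef) :
    ∃ T : Matrix B B ℂ, T.PosSemidef ∧ (dua P T - 1).PosSemidef := by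
  have hH := hPD.isHermitian
  have hpos := hPD.eigenvalues_pos
  set c : ℝ := ∑ i, (hH.eigenvalues i)⁻¹ with hc
  have hc0 : 0 ≤ c := Finset.sum_nonneg fun i _ => (inv_pos.2 (hpos i)).le
  refine ⟨(c : ℂ) • 1, PosSemidef.smul .one (by exact_mod_cast hc0), ?_⟩
  have e : dua P ((c : ℂ) • 1) = (c : ℂ) • trB P := by
    rw [map_smul, dua_apply, one_kronecker_one, Matrix.mul_one, hP.2]
  rw [e]
  have hsp := hH.spectral_theorem
  set U := hH.eigenvectorUnitary
  have e2 : (c : ℂ) • trB P - 1 = (U : Matrix A A ℂ) *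
      (diagonal fun i => (c : ℂ) * hH.eigenvalues i - 1) * star (U : Matrix A A ℂ) := by
    have : (diagonal fun i => (c : ℂ) * hH.eigenvalues i - 1) =
        (c : ℂ) • diagonal (RCLike.ofReal ∘ hH.eigenvalues) - (1 : Matrix A A ℂ) := by
      ext i j; by_cases hij : i = j <;> simp [hij, diagonal_apply, Matrix.one_apply]
    rw [this, Matrix.mul_sub, Matrix.sub_mul, Matrix.mul_one, Matrix.mul_smul, Matrix.smul_mul]
    have hu : (U : Matrix A A ℂ) * star (U : Matrix A A ℂ) = 1 := Unitary.mul_star_self_of_mem U.2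
    rw [hu]
    rw [Unitary.conjStarAlgAut_apply] at hsp
    exact congrArg (fun Z => (c : ℂ) • Z - 1) hsp
  rw [e2]
  refine PosSemidef.mul_mul_conjTranspose_same ?_ _
  refine PosSemidef.diagonal fun i => ?_
  have h1 : (hH.eigenvalues i)⁻¹ ≤ c :=
    Finset.single_le_sum (f := fun i => (hH.eigenvalues i)⁻¹)
      (fun i _ => (inv_pos.2 (hpos i)).le) (Finset.mem_univ i)
  have h2 : 1 ≤ c * hH.eigenvalues i := by
    have := mul_le_mul_of_nonneg_right h1 (hpos i).le
    rwa [inv_mul_cancel₀ (hpos i).ne'] at this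
  show (0:ℂ) ≤ (c : ℂ) * hH.eigenvalues i - 1
  rw [sub_nonneg]
  exact_mod_cast h2

lemma feas_bdd {P : Matrix (A × B) (A × B) ℂ} {T : Matrix B B ℂ} (hT : T.PosSemidef)
    (hT' : (dua P T - 1).PosSemidef) : BddAbove (feas P) :=
  ⟨T.trace.re, fun _ hx => weak hx hT hT'⟩

lemma strong {P : Matrix (A × B) (A × B) ℂ} (hP : IsProj P) (hPD : (trB P).PosDef)
    {β : ℝ} (hβ : AramTilde P < β) :
    ∃ T : Matrix B B ℂ, T.PosSemidef ∧ T.trace.re ≤ β ∧ (dua P T - 1).PosSemidef := by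
  obtain ⟨T₀, hT₀, hT₀'⟩ := exists_dual hP hPD
  have hb := feas_bdd hT₀ hT₀'
  have h0 : 0 ≤ AramTilde P := le_csSup hb (feas_zero P)
  by_contra hcon
  obtain ⟨S, hS, hS1, hS2⟩ := strong_duality (dua P) (fun T hT => dua_psd hP hT)
    (h0.trans_lt hβ) hcon
  have : S.trace.re ≤ AramTilde P := by
    refine le_csSup hb ⟨S, hS, rfl, ?_⟩
    refine psd_of_re (Matrix.isHermitian_one.sub (prim_psd hP hS).isHermitian) fun x => ?_
    change 0 ≤ ((1 - prim P S) * vecMulVec x (star x)).trace.re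
    have := hS2 x
    rw [adj] at this
    rw [Matrix.sub_mul, trace_sub, Complex.sub_re, Matrix.one_mul, trace_vecMulVec,
      dotProduct_comm]
    linarith
  linarith

end PT

section Prod
variable {A₁ B₁ A₂ B₂ : Type*} [Fintype A₁] [Fintype B₁] [Fintype A₂] [Fintype B₂]
    [DecidableEq A₁] [DecidableEq B₁] [DecidableEq A₂] [DecidableEq B₂]

lemma boxProd_mul (X X' : Matrix (A₁ × B₁) (A₁ × B₁) ℂ) (Y Y' : Matrix (A₂ × B₂) (A₂ × B₂) ℂ) :
    boxProd X Y * boxProd X' Y' = boxProd (X * X') (Y * Y') := by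
  have h : ∀ (X : Matrix (A₁ × B₁) (A₁ × B₁) ℂ) (Y : Matrix (A₂ × B₂) (A₂ × B₂) ℂ),
      boxProd X Y = (X ⊗ₖ Y).submatrix (Equiv.prodProdProdComm A₁ A₂ B₁ B₂)
        (Equiv.prodProdProdComm A₁ A₂ B₁ B₂) := fun X Y => rfl
  rw [h, h, h, submatrix_mul_equiv, mul_kronecker_mul]

lemma boxProd_kron (X : Matrix A₁ A₁ ℂ) (X' : Matrix B₁ B₁ ℂ) (Y : Matrix A₂ A₂ ℂ)
    (Y' : Matrix B₂ B₂ ℂ) : (X ⊗ₖ Y) ⊗ₖ (X' ⊗ₖ Y') = boxProd (X ⊗ₖ X') (Y ⊗ₖ Y') := by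
  ext i j; simp [boxProd]; ring

lemma trA_boxProd (X : Matrix (A₁ × B₁) (A₁ × B₁) ℂ) (Y : Matrix (A₂ × B₂) (A₂ × B₂) ℂ) :
    trA (boxProd X Y) = trA X ⊗ₖ trA Y := by
  ext i j; simp [boxProd, trA, Fintype.sum_prod_type, Finset.sum_mul_sum]

lemma trB_boxProd (X : Matrix (A₁ × B₁) (A₁ × B₁) ℂ) (Y : Matrix (A₂ × B₂) (A₂ × B₂) ℂ) :
    trB (boxProd X Y) = trB X ⊗ₖ trB Y := by
  ext i j; simp [boxProd, trB, Fintype.sum_prod_type, Finset.sum_mul_sum]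

lemma prim_boxProd (P₁ : Matrix (A₁ × B₁) (A₁ × B₁) ℂ) (P₂ : Matrix (A₂ × B₂) (A₂ × B₂) ℂ)
    (S₁ : Matrix A₁ A₁ ℂ) (S₂ : Matrix A₂ A₂ ℂ) :
    prim (boxProd P₁ P₂) (S₁ ⊗ₖ S₂) = prim P₁ S₁ ⊗ₖ prim P₂ S₂ := by
  rw [prim, ← one_kronecker_one, boxProd_kron, boxProd_mul, boxProd_mul, trA_boxProd]; rfl

lemma dua_boxProd (P₁ : Matrix (A₁ × B₁) (A₁ × B₁) ℂ) (P₂ : Matrix (A₂ × B₂) (A₂ × B₂) ℂ)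
    (S₁ : Matrix B₁ B₁ ℂ) (S₂ : Matrix B₂ B₂ ℂ) :
    dua (boxProd P₁ P₂) (S₁ ⊗ₖ S₂) = dua P₁ S₁ ⊗ₖ dua P₂ S₂ := by
  rw [dua_apply, ← one_kronecker_one, boxProd_kron, boxProd_mul, boxProd_mul, trB_boxProd]; rfl

lemma kron_le_one {X : Matrix A₁ A₁ ℂ} {Y : Matrix A₂ A₂ ℂ} (hX : X.PosSemidef)
    (hX1 : (1 - X).PosSemidef) (hY1 : (1 - Y).PosSemidef) : (1 - X ⊗ₖ Y).PosSemidef := by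
  have : 1 - X ⊗ₖ Y = (1 - X) ⊗ₖ (1 : Matrix A₂ A₂ ℂ) + X ⊗ₖ (1 - Y) := by
    rw [← one_kronecker_one (m := A₁) (n := A₂)]
    ext ⟨a, b⟩ ⟨c, d⟩
    simp only [Matrix.sub_apply, Matrix.add_apply, kroneckerMap_apply]
    ring
  rw [this]
  exact (hX1.kronecker .one).add (hX.kronecker hY1)

lemma one_le_kron {X : Matrix A₁ A₁ ℂ} {Y : Matrix A₂ A₂ ℂ}
    (hX1 : (X - 1).PosSemidef) (hY1 : (Y - 1).PosSemidef) : (X ⊗ₖ Y - 1).PosSemidef := by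
  have hY : Y.PosSemidef := by simpa using hY1.add .one
  have : X ⊗ₖ Y - 1 = (X - 1) ⊗ₖ Y + (1 : Matrix A₁ A₁ ℂ) ⊗ₖ (Y - 1) := by
    rw [← one_kronecker_one (m := A₁) (n := A₂)]
    ext ⟨a, b⟩ ⟨c, d⟩
    simp only [Matrix.sub_apply, Matrix.add_apply, kroneckerMap_apply]
    ring
  rw [this]
  exact (hX1.kronecker hY).add (PosSemidef.one.kronecker hY1)

lemma re_trace_kron {X : Matrix A₁ A₁ ℂ} {Y : Matrix A₂ A₂ ℂ} (hX : X.PosSemidef) :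
    (X ⊗ₖ Y).trace.re = X.trace.re * Y.trace.re := by
  rw [trace_kronecker, Complex.mul_re, ← (Complex.nonneg_iff.1 hX.trace_nonneg).2]
  simp

end Prod

end helpers

/-- The revised semidefinite packing number is multiplicative under tensor products. -/
theorem aramTilde_multiplicative
    {A₁ B₁ A₂ B₂ : Type*} [Fintype A₁] [Fintype B₁] [Fintype A₂] [Fintype B₂]
    [DecidableEq A₁] [DecidableEq B₁] [DecidableEq A₂] [DecidableEq B₂]
    [Nonempty A₁] [Nonempty B₁] [Nonempty A₂] [Nonempty B₂]
    (P₁ : Matrix (A₁ × B₁) (A₁ × B₁) ℂ) (P₂ : Matrix (A₂ × B₂) (A₂ × B₂) ℂ)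
    (hP₁ : IsProj P₁) (hP₂ : IsProj P₂)
    (hPD₁ : (trB P₁).PosDef) (hPD₂ : (trB P₂).PosDef) :
    AramTilde (boxProd P₁ P₂) = AramTilde P₁ * AramTilde P₂ := by
  have key : ∀ b₁ > AramTilde P₁, ∀ b₂ > AramTilde P₂,
      ∃ T, T.PosSemidef ∧ (dua (boxProd P₁ P₂) T - 1).PosSemidef ∧ T.trace.re ≤ b₁ * b₂ := by
    intro b₁ h₁ b₂ h₂
    obtain ⟨T₁, p₁, t₁, d₁⟩ := strong hP₁ hPD₁ h₁
    obtain ⟨T₂, p₂, t₂, d₂⟩ := strong hP₂ hPD₂ h₂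
    refine ⟨T₁ ⊗ₖ T₂, p₁.kronecker p₂, ?_, ?_⟩
    · rw [dua_boxProd]; exact one_le_kron d₁ d₂
    · rw [re_trace_kron p₁]
      have q₁ := (Complex.nonneg_iff.1 p₁.trace_nonneg).1
      have q₂ := (Complex.nonneg_iff.1 p₂.trace_nonneg).1
      exact mul_le_mul t₁ t₂ q₂ (q₁.trans t₁)
  obtain ⟨T₁, p₁, d₁⟩ := exists_dual hP₁ hPD₁
  obtain ⟨T₂, p₂, d₂⟩ := exists_dual hP₂ hPD₂
  have hb₁ := feas_bdd p₁ d₁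
  have hb₂ := feas_bdd p₂ d₂
  obtain ⟨T, p, d, -⟩ := key _ (lt_add_one _) _ (lt_add_one _)
  have hb := feas_bdd p d
  have hn₁ : 0 ≤ AramTilde P₁ := le_csSup hb₁ (feas_zero P₁)
  have hn : 0 ≤ AramTilde (boxProd P₁ P₂) := le_csSup hb (feas_zero _)
  apply le_antisymm
  · refine le_mul_of_forall_lt₀ fun b₁ h₁ b₂ h₂ => ?_
    obtain ⟨T, p, d, t⟩ := key b₁ h₁ b₂ h₂
    exact csSup_le ⟨0, feas_zero _⟩ fun x hx => (weak hx p d).trans t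
  · refine mul_le_of_forall_lt_of_nonneg hn₁ hn fun a ha0 ha b hb0 hbb => ?_
    obtain ⟨_, ⟨S₁, s₁, rfl, f₁⟩, l₁⟩ := exists_lt_of_lt_csSup ⟨0, feas_zero _⟩ ha
    obtain ⟨_, ⟨S₂, s₂, rfl, f₂⟩, l₂⟩ := exists_lt_of_lt_csSup ⟨0, feas_zero _⟩ hbb
    refine (mul_le_mul l₁.le l₂.le hb0 (ha0.trans l₁.le)).trans ?_
    rw [← re_trace_kron s₁]
    refine le_csSup hb ⟨S₁ ⊗ₖ S₂, s₁.kronecker s₂, rfl, ?_⟩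
    change (1 - prim (boxProd P₁ P₂) (S₁ ⊗ₖ S₂)).PosSemidef
    rw [prim_boxProd]
    exact kron_le_one (prim_psd hP₁ s₁) f₁ f₂
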